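/- arXiv:2007.00666 — 2 statements merged into one kernel-verified Lean document; each statement's English description precedes it below -/
import Mathlib

section
/- Let R > 0 and define P : ℝ → ℝ by P(Φ) = k_R(Φ/√2). Then for every Φ > 0, the derivative of the function Φ ↦ −Φ·P(Φ) + P'(Φ) at Φ equals R·P(Φ); i.e., P solves the stationary Fokker–Planck equation with stochastic resetting rate R, d/dΦ[V'(Φ)P(Φ) + P'(Φ)] = R·P(Φ), away from the resetting point Φ = 0, for the inverted quadratic (ferromagnetic) potential V(Φ) = −Φ²/2. -/
open Real MeasureTheory Filter Topology

/-- `kFun R x = ∫₀^∞ t^R exp(-t² - 2xt) dt`, i.e. `Γ(1+R) · H(-1-R, x)`. -/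
noncomputable def kFun (R x : ℝ) : ℝ :=
  ∫ t in Set.Ioi (0 : ℝ), t ^ R * Real.exp (-t ^ 2 - 2 * x * t)

/-- The low-temperature stationary profile `P(Φ) = k_R(Φ/√2)`. -/
noncomputable def Pfun (R : ℝ) : ℝ → ℝ :=
  fun Φ => kFun R (Φ / Real.sqrt 2)

theorem exponent_le (x t : ℝ) : -t ^ 2 - 2 * x * t ≤ 2 * x ^ 2 + -(1 / 2) * t ^ 2 := by
  nlinarith [sq_nonneg (t + 2 * x)]

theorem continuousOn_rpow_mul_exp (s x : ℝ) :
    ContinuousOn (fun t : ℝ => t ^ s * Real.exp (-t ^ 2 - 2 * x * t)) (Set.Ioi 0) := by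
  refine ContinuousOn.mul (fun t ht => ?_) (by fun_prop)
  exact (Real.continuousAt_rpow_const t s (Or.inl (ne_of_gt ht))).continuousWithinAt

theorem integrableOn_rpow_mul_exp {s : ℝ} (hs : -1 < s) (x : ℝ) :
    IntegrableOn (fun t : ℝ => t ^ s * Real.exp (-t ^ 2 - 2 * x * t)) (Set.Ioi 0) := by
  have h := (integrableOn_rpow_mul_exp_neg_mul_sq (b := 1 / 2) (by norm_num) hs).const_mul
    (Real.exp (2 * x ^ 2))
  refine Integrable.mono' h
    ((continuousOn_rpow_mul_exp s x).aestronglyMeasurable measurableSet_Ioi) ?_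
  refine (ae_restrict_mem measurableSet_Ioi).mono fun t ht => ?_
  have ht0 : 0 ≤ t ^ s := Real.rpow_nonneg (le_of_lt ht) s
  rw [Real.norm_of_nonneg (by positivity), mul_left_comm, ← Real.exp_add]
  exact mul_le_mul_of_nonneg_left (Real.exp_le_exp.2 (exponent_le x t)) ht0

theorem hasDerivAt_kFun {s : ℝ} (hs : -1 < s) (x : ℝ) :
    HasDerivAt (kFun s) (-2 * kFun (s + 1) x) x := by
  have key := (hasDerivAt_integral_of_dominated_loc_of_deriv_le
    (μ := volume.restrict (Set.Ioi (0 : ℝ))) (x₀ := x) (s := Metric.ball x 1)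
    (F := fun y t => t ^ s * Real.exp (-t ^ 2 - 2 * y * t))
    (F' := fun y t => -2 * (t ^ (s + 1) * Real.exp (-t ^ 2 - 2 * y * t)))
    (bound := fun t => 2 * (t ^ (s + 1) * Real.exp (-t ^ 2 - 2 * (x - 1) * t)))
    (Metric.ball_mem_nhds x one_pos)
    (Eventually.of_forall fun y =>
      (continuousOn_rpow_mul_exp s y).aestronglyMeasurable measurableSet_Ioi)
    (integrableOn_rpow_mul_exp hs x)
    ((integrableOn_rpow_mul_exp (by linarith) x).const_mul (-2)).aestronglyMeasurable
    ?_ ((integrableOn_rpow_mul_exp (by linarith) (x - 1)).const_mul 2) ?_).2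
  · rw [integral_const_mul] at key
    exact key
  · refine (ae_restrict_mem measurableSet_Ioi).mono fun t ht y hy => ?_
    have ht : 0 < t := ht
    rw [Real.ball_eq_Ioo] at hy
    have ht0 : 0 ≤ t ^ (s + 1) := Real.rpow_nonneg ht.le _
    rw [norm_mul, Real.norm_of_nonneg (mul_nonneg ht0 (Real.exp_pos _).le), norm_neg,
      Real.norm_ofNat]
    have : -t ^ 2 - 2 * y * t ≤ -t ^ 2 - 2 * (x - 1) * t := by nlinarith [hy.1]
    gcongr
  · refine (ae_restrict_mem measurableSet_Ioi).mono fun t ht y _ => ?_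
    have ht : 0 < t := ht
    have h : HasDerivAt (fun y : ℝ => -t ^ 2 - 2 * y * t) (-(2 * t)) y := by
      simpa using (((hasDerivAt_id y).const_mul 2).mul_const t).const_sub (-t ^ 2)
    refine (h.exp.const_mul (t ^ s)).congr_deriv ?_
    rw [Real.rpow_add_one ht.ne']
    ring

theorem kFun_recurrence {s : ℝ} (hs : -1 < s) (x : ℝ) :
    2 * kFun (s + 1 + 1) x + 2 * x * kFun (s + 1) x = (s + 1) * kFun s x := by
  have hs1 : 0 < s + 1 := by linarith
  have i0 := integrableOn_rpow_mul_exp hs x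
  have i1 := integrableOn_rpow_mul_exp (s := s + 1) (by linarith) x
  have i2 := integrableOn_rpow_mul_exp (s := s + 1 + 1) (by linarith) x
  have hderiv : ∀ t ∈ Set.Ioi (0 : ℝ),
      HasDerivAt (fun t : ℝ => t ^ (s + 1) * Real.exp (-t ^ 2 - 2 * x * t))
        ((s + 1) * (t ^ s * Real.exp (-t ^ 2 - 2 * x * t))
          - 2 * (t ^ (s + 1 + 1) * Real.exp (-t ^ 2 - 2 * x * t))
          - 2 * x * (t ^ (s + 1) * Real.exp (-t ^ 2 - 2 * x * t))) t := by
    intro t ht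
    have ht : 0 < t := ht
    have h : HasDerivAt (fun t : ℝ => -t ^ 2 - 2 * x * t) (-(2 * t) - 2 * x) t := by
      refine ((hasDerivAt_pow 2 t).fun_neg.fun_sub
        ((hasDerivAt_id t).const_mul (2 * x))).congr_deriv ?_
      simp
    refine ((Real.hasDerivAt_rpow_const (p := s + 1) (Or.inl ht.ne')).mul h.exp).congr_deriv ?_
    rw [add_sub_cancel_right, Real.rpow_add_one ht.ne' (s + 1)]
    ring
  have i02 : IntegrableOn (fun t : ℝ => (s + 1) * (t ^ s * Real.exp (-t ^ 2 - 2 * x * t))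
      - 2 * (t ^ (s + 1 + 1) * Real.exp (-t ^ 2 - 2 * x * t))) (Set.Ioi 0) :=
    (i0.const_mul (s + 1)).sub (i2.const_mul 2)
  have hint := i02.sub (i1.const_mul (2 * x))
  have hcont : ContinuousWithinAt
      (fun t : ℝ => t ^ (s + 1) * Real.exp (-t ^ 2 - 2 * x * t)) (Set.Ici 0) 0 := by
    refine (ContinuousAt.mul ?_ (by fun_prop)).continuousWithinAt
    exact Real.continuousAt_rpow_const 0 (s + 1) (Or.inr hs1.le)
  have key := integral_Ioi_of_hasDerivAt_of_tendsto hcont hderiv hint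
    (tendsto_zero_of_hasDerivAt_of_integrableOn_Ioi hderiv hint i1)
  rw [integral_sub i02 (i1.const_mul (2 * x)),
    integral_sub (i0.const_mul (s + 1)) (i2.const_mul 2),
    integral_const_mul, integral_const_mul, integral_const_mul,
    Real.zero_rpow hs1.ne', zero_mul, sub_zero] at key
  unfold kFun
  linarith

theorem hasDerivAt_Pfun {s : ℝ} (hs : -1 < s) (Φ : ℝ) :
    HasDerivAt (Pfun s) (-Real.sqrt 2 * Pfun (s + 1) Φ) Φ := by
  have h := (hasDerivAt_kFun hs (Φ / Real.sqrt 2)).comp Φ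
    ((hasDerivAt_id Φ).div_const (Real.sqrt 2))
  refine h.congr_deriv ?_
  have h2 : Real.sqrt 2 * Real.sqrt 2 = 2 := Real.mul_self_sqrt (by norm_num)
  unfold Pfun
  field_simp
  linear_combination kFun (s + 1) (Φ / Real.sqrt 2) * h2

/-- For `R > 0` and `P(Φ) = k_R(Φ/√2)`, for every `Φ > 0` the derivative of
`Φ ↦ -Φ·P(Φ) + P'(Φ)` at `Φ` equals `R·P(Φ)`: `P` solves the stationary Fokker–Planck
equation with resetting rate `R` away from `Φ = 0`, for the inverted potential
`V(Φ) = -Φ²/2`. -/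
theorem stationary_FP_low_temperature (R : ℝ) (hR : 0 < R) :
    ∀ Φ : ℝ, 0 < Φ →
      HasDerivAt (fun Ψ : ℝ => -Ψ * Pfun R Ψ + deriv (Pfun R) Ψ) (R * Pfun R Φ) Φ := by
  intro Φ _
  have hR1 : -1 < R := by linarith
  have hderiv : deriv (Pfun R) = fun Ψ => -Real.sqrt 2 * Pfun (R + 1) Ψ :=
    funext fun Ψ => (hasDerivAt_Pfun hR1 Ψ).deriv
  rw [hderiv]
  refine (((hasDerivAt_id Φ).neg.mul (hasDerivAt_Pfun hR1 Φ)).add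
    ((hasDerivAt_Pfun (s := R + 1) (by linarith) Φ).const_mul (-Real.sqrt 2))).congr_deriv ?_
  have h2 : Real.sqrt 2 * Real.sqrt 2 = 2 := Real.mul_self_sqrt (by norm_num)
  have hΦ : 2 * (Φ / Real.sqrt 2) = Φ * Real.sqrt 2 := by
    rw [mul_div_assoc', div_eq_iff (by positivity)]
    linear_combination -Φ * h2
  have hrec : 2 * Pfun (R + 1 + 1) Φ + 2 * (Φ / Real.sqrt 2) * Pfun (R + 1) Φ
      = (R + 1) * Pfun R Φ := kFun_recurrence hR1 (Φ / Real.sqrt 2)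
  rw [hΦ] at hrec
  simp only [Pi.neg_apply, id]
  linear_combination hrec + Pfun (R + 1 + 1) Φ * h2
end

section
/- For every real R > 0, the strict Gamma-function inequality 2·Γ(1 + R/2)² > (R + 1/2)·Γ((1+R)/2)² holds. Consequently, the cubic coefficient c₃ = (c₁/3)·(c₁² − 1/2 − R) of the low-temperature non-equilibrium Landau potential, where c₁ = √2·Γ(1+R/2)/Γ((1+R)/2), is strictly positive for all R > 0. -/
open Real

/-- The linear coefficient `c₁ = √2·Γ(1+R/2)/Γ((1+R)/2)`. -/
noncomputable def c₁ (R : ℝ) : ℝ :=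
  Real.sqrt 2 * Real.Gamma (1 + R / 2) / Real.Gamma ((1 + R) / 2)

open Filter Topology

/-- Midpoint log-convexity of the Gamma function. -/
theorem sub_half_mul_sq_Gamma_le {x : ℝ} (hx : 1 / 2 < x) :
    (x - 1 / 2) * Real.Gamma x ^ 2 ≤ Real.Gamma (x + 1 / 2) ^ 2 := by
  have h := Real.Gamma_mul_add_mul_le_rpow_Gamma_mul_rpow_Gamma (s := x - 1 / 2) (t := x + 1 / 2)
    (a := 1 / 2) (b := 1 / 2) (by linarith) (by linarith) (by norm_num) (by norm_num)
    (by norm_num)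
  have hx1 : (0 : ℝ) < x - 1 / 2 := by linarith
  have hA := Real.Gamma_pos_of_pos hx1
  have hB : 0 < Real.Gamma (x + 1 / 2) := Real.Gamma_pos_of_pos (by linarith)
  have hC : 0 < Real.Gamma x := Real.Gamma_pos_of_pos (by linarith)
  rw [show 1 / 2 * (x - 1 / 2) + 1 / 2 * (x + 1 / 2) = x by ring, ← Real.sqrt_eq_rpow,
    ← Real.sqrt_eq_rpow, ← Real.sqrt_mul hA.le, Real.le_sqrt hC.le (by positivity)] at h
  have hrec : Real.Gamma (x + 1 / 2) = (x - 1 / 2) * Real.Gamma (x - 1 / 2) := by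
    rw [← Real.Gamma_add_one hx1.ne']
    ring_nf
  calc (x - 1 / 2) * Real.Gamma x ^ 2
      ≤ (x - 1 / 2) * (Real.Gamma (x - 1 / 2) * Real.Gamma (x + 1 / 2)) := by gcongr
    _ = Real.Gamma (x + 1 / 2) ^ 2 := by rw [sq, ← mul_assoc, ← hrec]

/-- The ratio of `Γ(x + 1/2)²` to `(x - 1/4) Γ(x)²`. -/
noncomputable def gammaHalfRatio (x : ℝ) : ℝ :=
  Real.Gamma (x + 1 / 2) ^ 2 / ((x - 1 / 4) * Real.Gamma x ^ 2)

theorem gammaHalfRatio_add_one_lt {x : ℝ} (hx : 1 / 2 < x) :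
    gammaHalfRatio (x + 1) < gammaHalfRatio x := by
  have hB : 0 < Real.Gamma (x + 1 / 2) := Real.Gamma_pos_of_pos (by linarith)
  have hC : 0 < Real.Gamma x := Real.Gamma_pos_of_pos (by linarith)
  have hx0 : 0 < x := by linarith
  have hx1 : 0 < x - 1 / 4 := by linarith
  have hx2 : 0 < x + 1 - 1 / 4 := by linarith
  unfold gammaHalfRatio
  rw [show x + 1 + 1 / 2 = x + 1 / 2 + 1 by ring, Real.Gamma_add_one (by linarith),
    Real.Gamma_add_one hx0.ne', div_lt_div_iff₀ (by positivity) (by positivity)]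
  have hpoly : (x + 1 / 2) ^ 2 * (x - 1 / 4) < (x + 1 - 1 / 4) * x ^ 2 := by nlinarith
  have hpos : 0 < Real.Gamma (x + 1 / 2) ^ 2 * Real.Gamma x ^ 2 := by positivity
  calc _ = (x + 1 / 2) ^ 2 * (x - 1 / 4) * (Real.Gamma (x + 1 / 2) ^ 2 * Real.Gamma x ^ 2) := by
        ring
    _ < (x + 1 - 1 / 4) * x ^ 2 * (Real.Gamma (x + 1 / 2) ^ 2 * Real.Gamma x ^ 2) := by gcongr
    _ = _ := by ring

theorem gammaHalfRatio_add_nat_le {x : ℝ} (hx : 1 / 2 < x) (n : ℕ) :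
    gammaHalfRatio (x + n) ≤ gammaHalfRatio x := by
  induction n with
  | zero => simp
  | succ k ih =>
    have hk : (0 : ℝ) ≤ k := k.cast_nonneg
    push_cast
    rw [← add_assoc]
    exact (gammaHalfRatio_add_one_lt (by linarith)).le.trans ih

theorem one_sub_le_gammaHalfRatio {x : ℝ} (hx : 1 / 2 < x) :
    1 - 1 / 4 / (x - 1 / 4) ≤ gammaHalfRatio x := by
  have hC : 0 < Real.Gamma x := Real.Gamma_pos_of_pos (by linarith)
  have hx1 : 0 < x - 1 / 4 := by linarith
  unfold gammaHalfRatio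
  rw [le_div_iff₀ (by positivity)]
  calc _ = (x - 1 / 2) * Real.Gamma x ^ 2 := by
        have h : 1 / 4 / (x - 1 / 4) * (x - 1 / 4) = 1 / 4 := div_mul_cancel₀ _ hx1.ne'
        linear_combination -Real.Gamma x ^ 2 * h
    _ ≤ _ := sub_half_mul_sq_Gamma_le hx

theorem one_le_gammaHalfRatio {x : ℝ} (hx : 1 / 2 < x) : 1 ≤ gammaHalfRatio x := by
  have hlim : Tendsto (fun n : ℕ => 1 - 1 / 4 / (x + n - 1 / 4)) atTop (𝓝 1) := by
    have h : Tendsto (fun n : ℕ => x + (n : ℝ) - 1 / 4) atTop atTop :=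
      tendsto_atTop_add_const_right _ _
        (tendsto_atTop_add_const_left _ _ tendsto_natCast_atTop_atTop)
    simpa using (h.const_div_atTop (1 / 4)).const_sub 1
  refine le_of_tendsto' hlim fun n => ?_
  have hn : (0 : ℝ) ≤ n := n.cast_nonneg
  exact (one_sub_le_gammaHalfRatio (by linarith)).trans (gammaHalfRatio_add_nat_le hx n)

/-- A strict lower bound of Watson type for the ratio `Γ(x + 1/2) / Γ(x)`. -/
theorem sub_quarter_mul_sq_Gamma_lt {x : ℝ} (hx : 1 / 2 < x) :
    (x - 1 / 4) * Real.Gamma x ^ 2 < Real.Gamma (x + 1 / 2) ^ 2 := by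
  have hC : 0 < Real.Gamma x := Real.Gamma_pos_of_pos (by linarith)
  have hx1 : 0 < x - 1 / 4 := by linarith
  have h : 1 < gammaHalfRatio x :=
    (one_le_gammaHalfRatio (x := x + 1) (by linarith)).trans_lt (gammaHalfRatio_add_one_lt hx)
  unfold gammaHalfRatio at h
  rwa [one_lt_div (by positivity)] at h

/-- For every `R > 0` one has `2·Γ(1+R/2)² > (R+1/2)·Γ((1+R)/2)²`; consequently the cubic
coefficient `c₃ = (c₁/3)(c₁² - 1/2 - R)`, with `c₁ = √2·Γ(1+R/2)/Γ((1+R)/2)`, of the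
low-temperature non-equilibrium Landau potential is strictly positive. -/
theorem gamma_inequality_c3_positive (R : ℝ) (hR : 0 < R) :
    2 * Real.Gamma (1 + R / 2) ^ 2 > (R + 1 / 2) * Real.Gamma ((1 + R) / 2) ^ 2 ∧
    0 < (c₁ R / 3) * (c₁ R ^ 2 - 1 / 2 - R) := by
  have hB : 0 < Real.Gamma (1 + R / 2) := Real.Gamma_pos_of_pos (by linarith)
  have hC : 0 < Real.Gamma ((1 + R) / 2) := Real.Gamma_pos_of_pos (by linarith)
  have key : (R + 1 / 2) * Real.Gamma ((1 + R) / 2) ^ 2 < 2 * Real.Gamma (1 + R / 2) ^ 2 := by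
    have h := sub_quarter_mul_sq_Gamma_lt (x := (1 + R) / 2) (by linarith)
    rw [show (1 + R) / 2 + 1 / 2 = 1 + R / 2 by ring] at h
    linarith
  refine ⟨key, ?_⟩
  have hc : 0 < c₁ R := by
    unfold c₁
    positivity
  have hsq : R + 1 / 2 < c₁ R ^ 2 := by
    unfold c₁
    rwa [div_pow, mul_pow, Real.sq_sqrt (by norm_num), lt_div_iff₀ (by positivity)]
  exact mul_pos (by positivity) (by linarith)
end
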